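/- Fix λ > 0 and truncation bound R > 0. For the rectangular grid discrete convolution approximation Z of the canonical OU∧ process Y with c = 1, Lévy seed mean μ and variance τ², the mean squared error satisfies E[|Y_t(x) − Z_t(x)|²] = [4μ²λ⁻⁴(1+λR)² + τ²(2λ²)⁻¹(1+2λR)] e^{-2Rλ} + O(Δ) as the grid size Δ → 0. In particular, the pure-truncation error (Δ = 0 limit) of approximating Y by the integral over A_t(x) ∩ {t-s ≤ R} equals (∫_{truncated region complement} k μ)² + ∫_{complement} k² τ², where k(ξ,s) = 𝟙_{A_t(x)} e^{-λ(t-s)}, which evaluates to 4μ²λ⁻⁴(1+λR)² e^{-2Rλ} + τ²(2λ²)⁻¹(1+2λR) e^{-2Rλ}. -/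

import Mathlib

open MeasureTheory Real Filter Asymptotics

lemma volume_vertical_band {a : ℝ → ℝ} (ha : Measurable a) (c d r : ℝ) :
    MeasurableSet {p : ℝ × ℝ | p.2 ∈ Set.Icc c d ∧ |p.1 - a p.2| ≤ r} ∧
    volume {p : ℝ × ℝ | p.2 ∈ Set.Icc c d ∧ |p.1 - a p.2| ≤ r}
      = ENNReal.ofReal (2 * r) * ENNReal.ofReal (d - c) := by
  have hm : MeasurableSet {p : ℝ × ℝ | p.2 ∈ Set.Icc c d ∧ |p.1 - a p.2| ≤ r} := by
    refine (measurable_snd measurableSet_Icc).inter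
      (measurableSet_le (f := fun p : ℝ × ℝ => |p.1 - a p.2|) ?_ measurable_const)
    simp_rw [← Real.norm_eq_abs]
    fun_prop
  refine ⟨hm, ?_⟩
  rw [Measure.volume_eq_prod, Measure.prod_apply_symm hm]
  have hfib : ∀ s : ℝ, volume ((fun ξ : ℝ => (ξ, s)) ⁻¹'
      {p : ℝ × ℝ | p.2 ∈ Set.Icc c d ∧ |p.1 - a p.2| ≤ r})
      = (Set.Icc c d).indicator (fun _ => ENNReal.ofReal (2 * r)) s := by
    intro s
    by_cases hs : s ∈ Set.Icc c d
    · have : (fun ξ : ℝ => (ξ, s)) ⁻¹' {p : ℝ × ℝ | p.2 ∈ Set.Icc c d ∧ |p.1 - a p.2| ≤ r}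
          = Set.Icc (a s - r) (a s + r) := by
        ext ξ
        simp only [Set.mem_preimage, Set.mem_ofPred_eq, hs, true_and, abs_le,
          Set.mem_Icc (a := a s - r)]
        constructor <;> rintro ⟨h1, h2⟩ <;> constructor <;> linarith
      rw [this, Real.volume_Icc, Set.indicator_of_mem hs]
      congr 1; ring
    · have : (fun ξ : ℝ => (ξ, s)) ⁻¹' {p : ℝ × ℝ | p.2 ∈ Set.Icc c d ∧ |p.1 - a p.2| ≤ r} = ∅ :=
        Set.eq_empty_of_forall_notMem fun ξ hξ => hs hξ.1
      rw [this, measure_empty, Set.indicator_of_notMem hs]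
  simp_rw [hfib]
  rw [lintegral_indicator measurableSet_Icc, setLIntegral_const, Real.volume_Icc]

lemma integrableOn_and_integral_Ioi_mul_exp {c : ℝ} (hc : 0 < c) {R : ℝ} (hR : 0 < R) :
    IntegrableOn (fun u => 2 * u * exp (-(c * u))) (Set.Ioi R) ∧
    ∫ u in Set.Ioi R, 2 * u * exp (-(c * u)) = 2 * (1 + c * R) * exp (-(c * R)) / c ^ 2 := by
  have hd : ∀ u ∈ Set.Ici R, HasDerivAt (fun u => -(2 * (1 + c * u) * exp (-(c * u)) / c ^ 2))
      (2 * u * exp (-(c * u))) u := by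
    intro u _
    have h1 : HasDerivAt (fun u => c * u) c u := by simpa using (hasDerivAt_id u).const_mul c
    have h2 := (((h1.const_add 1).const_mul 2).mul h1.neg.exp).div_const (c ^ 2)
    refine h2.neg.congr_deriv ?_
    simp only [Pi.neg_apply]
    field_simp
    ring
  have hpos : ∀ u ∈ Set.Ioi R, 0 ≤ 2 * u * exp (-(c * u)) := by
    intro u hu
    have : 0 < u := hR.trans hu
    positivity
  have hlim : Tendsto (fun u => -(2 * (1 + c * u) * exp (-(c * u)) / c ^ 2)) atTop (nhds 0) := by
    have hcu : Tendsto (fun u : ℝ => c * u) atTop atTop := tendsto_id.const_mul_atTop hc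
    have h0 := (tendsto_pow_mul_exp_neg_atTop_nhds_zero 0).comp hcu
    have h1 := (tendsto_pow_mul_exp_neg_atTop_nhds_zero 1).comp hcu
    have := ((h0.add h1).const_mul (-(2 / c ^ 2)))
    simp only [Function.comp_def, pow_zero, pow_one, add_zero, mul_zero] at this
    refine this.congr fun u => ?_
    ring
  refine ⟨integrableOn_Ioi_deriv_of_nonneg' hd hpos hlim, ?_⟩
  rw [integral_Ioi_of_hasDerivAt_of_nonneg' hd hpos hlim]
  ring

lemma integrableOn_and_setIntegral_truncated_cone_exp {c : ℝ} (hc : 0 < c) {R : ℝ} (hR : 0 < R)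
    (x t : ℝ) :
    MeasurableSet {p : ℝ × ℝ | R < t - p.2 ∧ |p.1 - x| ≤ t - p.2} ∧
    IntegrableOn (fun p : ℝ × ℝ => exp (-(c * (t - p.2))))
      {p : ℝ × ℝ | R < t - p.2 ∧ |p.1 - x| ≤ t - p.2} ∧
    ∫ p in {p : ℝ × ℝ | R < t - p.2 ∧ |p.1 - x| ≤ t - p.2}, exp (-(c * (t - p.2)))
      = 2 * (1 + c * R) * exp (-(c * R)) / c ^ 2 := by
  set A := {p : ℝ × ℝ | R < t - p.2 ∧ |p.1 - x| ≤ t - p.2} with hA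
  have hm : MeasurableSet A := by
    refine (measurableSet_lt (g := fun p : ℝ × ℝ => t - p.2) measurable_const (by fun_prop)).inter
      (measurableSet_le (f := fun p : ℝ × ℝ => |p.1 - x|) (g := fun p => t - p.2) ?_ (by fun_prop))
    simp_rw [← Real.norm_eq_abs]
    fun_prop
  set φ : ℝ → ℝ := (Set.Ioi R).indicator (fun u => 2 * u * exp (-(c * u))) with hφ
  obtain ⟨hi, hv⟩ := integrableOn_and_integral_Ioi_mul_exp hc hR
  have hφi : Integrable φ := hi.integrable_indicator measurableSet_Ioi
  set f : ℝ × ℝ → ℝ := A.indicator (fun p => exp (-(c * (t - p.2)))) with hf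
  have hfib : ∀ s, (fun ξ => f (ξ, s)) = if R < t - s then
      (Set.Icc (x - (t - s)) (x + (t - s))).indicator (fun _ => exp (-(c * (t - s))))
      else 0 := by
    intro s
    ext ξ
    by_cases hs : R < t - s
    · have : (ξ, s) ∈ A ↔ ξ ∈ Set.Icc (x - (t - s)) (x + (t - s)) := by
        simp only [hA, Set.mem_ofPred_eq, hs, true_and, abs_le, Set.mem_Icc]
        constructor <;> rintro ⟨h1, h2⟩ <;> constructor <;> linarith
      simp only [hf, Set.indicator, this, hs, if_true]
    · have : (ξ, s) ∉ A := fun h => hs h.1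
      simp [hf, this, hs]
  have hnn : ∀ p, 0 ≤ f p := fun p => Set.indicator_nonneg (fun _ _ => (exp_pos _).le) p
  have hfib_integral : ∀ s, ∫ ξ, f (ξ, s) = φ (t - s) := by
    intro s
    rw [hfib]
    by_cases hs : R < t - s
    · rw [if_pos hs, integral_indicator measurableSet_Icc]
      have : 0 < t - s := hR.trans hs
      simp only [integral_const, measureReal_restrict_apply_univ, hφ, Set.indicator, Set.mem_Ioi,
        hs, if_true, smul_eq_mul]
      rw [Real.volume_real_Icc_of_le (by linarith)]
      ring
    · simp [hs, hφ]
  have hfi : Integrable f := by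
    have hfm : AEStronglyMeasurable f ((volume : Measure ℝ).prod volume) :=
      (Measurable.indicator (by fun_prop) hm).aestronglyMeasurable
    rw [Measure.volume_eq_prod, integrable_prod_iff' hfm]
    constructor
    · refine Eventually.of_forall fun s => ?_
      rw [hfib]
      split_ifs
      · exact (integrable_indicator_iff measurableSet_Icc).2 (by simp)
      · exact integrable_zero _ _ _
    · simp_rw [Real.norm_of_nonneg (hnn _), hfib_integral]
      exact hφi.comp_sub_left t
  refine ⟨hm, (integrable_indicator_iff hm).1 hfi, ?_⟩
  rw [← integral_indicator hm, Measure.volume_eq_prod, integral_prod_symm _ hfi]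
  rw [show (∫ s, ∫ ξ, A.indicator (fun p => exp (-(c * (t - p.2)))) (ξ, s)) = ∫ s, φ (t - s) from
    integral_congr_ae (Eventually.of_forall hfib_integral), integral_sub_left_eq_self φ,
    integral_indicator measurableSet_Ioi, hv]

/-- At most one grid cell contains a given point, so the grid sum reduces to one term. -/
lemma sum_grid_cells_eq (lam x t Δ : ℝ) (hΔ : 0 < Δ) (n : ℕ) (p : ℝ × ℝ) :
    (∑ j ∈ Finset.range (n + 1), ∑ i ∈ Finset.Icc (-(n : ℤ)) (n : ℤ),
        if |(i : ℝ) * Δ| ≤ (j : ℝ) * Δ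
            ∧ p.2 ∈ Set.Ioc (t - ((j : ℝ) + 1) * Δ) (t - (j : ℝ) * Δ)
            ∧ p.1 ∈ Set.Ico (x + (i : ℝ) * Δ - Δ / 2) (x + (i : ℝ) * Δ + Δ / 2)
        then exp (-(lam * (j : ℝ) * Δ)) else 0)
      = if 0 ≤ t - p.2 ∧ ⌊(t - p.2) / Δ⌋₊ ≤ n ∧
          |⌊(p.1 - x) / Δ + 1 / 2⌋| ≤ (⌊(t - p.2) / Δ⌋₊ : ℤ)
        then exp (-(lam * (⌊(t - p.2) / Δ⌋₊ : ℝ) * Δ)) else 0 := by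
  have hcell : ∀ (j : ℕ) (i : ℤ), (|(i : ℝ) * Δ| ≤ (j : ℝ) * Δ
            ∧ p.2 ∈ Set.Ioc (t - ((j : ℝ) + 1) * Δ) (t - (j : ℝ) * Δ)
            ∧ p.1 ∈ Set.Ico (x + (i : ℝ) * Δ - Δ / 2) (x + (i : ℝ) * Δ + Δ / 2)) ↔
      |i| ≤ (j : ℤ) ∧ (0 ≤ t - p.2 ∧ j = ⌊(t - p.2) / Δ⌋₊) ∧ i = ⌊(p.1 - x) / Δ + 1 / 2⌋ := by
    intro j i
    refine and_congr ?_ (and_congr ?_ ?_)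
    · rw [abs_mul, abs_of_pos hΔ, mul_le_mul_iff_left₀ hΔ]
      exact_mod_cast Iff.rfl
    · rw [Set.mem_Ioc]
      constructor
      · rintro ⟨h1, h2⟩
        have h0 : 0 ≤ (j : ℝ) * Δ := by positivity
        have hu : 0 ≤ t - p.2 := by linarith
        refine ⟨hu, ((Nat.floor_eq_iff (by positivity)).2 ⟨?_, ?_⟩).symm⟩
        · rw [le_div_iff₀ hΔ]; linarith
        · rw [div_lt_iff₀ hΔ]; linarith
      · rintro ⟨hu, hj⟩
        obtain ⟨h1, h2⟩ := (Nat.floor_eq_iff (by positivity)).1 hj.symm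
        rw [le_div_iff₀ hΔ] at h1
        rw [div_lt_iff₀ hΔ] at h2
        constructor <;> linarith
    · rw [Set.mem_Ico, eq_comm, Int.floor_eq_iff, ← sub_le_iff_le_add, ← lt_sub_iff_add_lt,
        le_div_iff₀ hΔ, div_lt_iff₀ hΔ]
      constructor <;> rintro ⟨h1, h2⟩ <;> constructor <;> linarith
  simp_rw [hcell]
  set J := ⌊(t - p.2) / Δ⌋₊
  set I := ⌊(p.1 - x) / Δ + 1 / 2⌋
  by_cases hc : 0 ≤ t - p.2 ∧ J ≤ n ∧ |I| ≤ (J : ℤ)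
  · obtain ⟨h0, hJ, hI⟩ := hc
    rw [Finset.sum_eq_single J, Finset.sum_eq_single I]
    · simp [h0, hJ, hI]
    · intro i _ hi; simp [hi]
    · intro hI'
      exfalso; apply hI'
      rw [Finset.mem_Icc, ← abs_le]
      exact hI.trans (by exact_mod_cast hJ)
    · intro j _ hj; simp [hj]
    · intro hJ'
      exact absurd (Finset.mem_range.2 (by omega)) hJ'
  · rw [if_neg hc]
    refine Finset.sum_eq_zero fun j hj => Finset.sum_eq_zero fun i _ => if_neg ?_
    rintro ⟨h1, ⟨h2, rfl⟩, rfl⟩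
    exact hc ⟨h2, by have := Finset.mem_range.1 hj; omega, h1⟩

/-- The grid approximation differs from the truncated cone kernel by at most the discretisation
error of the exponential, except near the boundary of the truncated cone. -/
lemma abs_kernel_sub_grid_sub_tail_le {lam Δ R : ℝ} (hlam : 0 < lam) (hΔ : 0 < Δ) {n : ℕ}
    (hn : R = n * Δ) (u v : ℝ) :
    |(if 0 ≤ u ∧ |v| ≤ u then exp (-(lam * u)) else 0)
      - (if 0 ≤ u ∧ ⌊u / Δ⌋₊ ≤ n ∧ |⌊v / Δ + 1 / 2⌋| ≤ (⌊u / Δ⌋₊ : ℤ)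
          then exp (-(lam * (⌊u / Δ⌋₊ : ℝ) * Δ)) else 0)
      - (if R < u ∧ |v| ≤ u then exp (-(lam * u)) else 0)|
    ≤ (if (0 ≤ u ∧ u ≤ R) ∧ |v| ≤ R then lam * Δ else 0)
      + (if (0 ≤ u ∧ u ≤ R) ∧ |v - u| ≤ Δ then 1 else 0)
      + (if (0 ≤ u ∧ u ≤ R) ∧ |v + u| ≤ Δ then 1 else 0)
      + (if (R ≤ u ∧ u ≤ R + Δ) ∧ |v| ≤ R + 2 * Δ then 1 else 0) := by
  have hR : 0 ≤ R := hn ▸ by positivity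
  have hlΔ : 0 ≤ lam * Δ := by positivity
  have n1 : (0 : ℝ) ≤ if (0 ≤ u ∧ u ≤ R) ∧ |v| ≤ R then lam * Δ else 0 := by
    split_ifs <;> simp [hlΔ]
  have n2 : (0 : ℝ) ≤ if (0 ≤ u ∧ u ≤ R) ∧ |v - u| ≤ Δ then 1 else 0 := by
    split_ifs <;> simp
  have n3 : (0 : ℝ) ≤ if (0 ≤ u ∧ u ≤ R) ∧ |v + u| ≤ Δ then 1 else 0 := by
    split_ifs <;> simp
  have n4 : (0 : ℝ) ≤ if (R ≤ u ∧ u ≤ R + Δ) ∧ |v| ≤ R + 2 * Δ then 1 else 0 := by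
    split_ifs <;> simp
  by_cases hu : 0 ≤ u
  swap
  · have : ¬ R < u := by linarith
    simp only [hu, this, false_and, if_false, sub_zero, abs_zero]
    simp only [hu, false_and, if_false] at n1 n2 n3
    linarith
  set J := ⌊u / Δ⌋₊ with hJ
  set I := ⌊v / Δ + 1 / 2⌋ with hI
  obtain ⟨hJ1, hJ2⟩ := (Nat.floor_eq_iff (div_nonneg hu hΔ.le)).1 hJ.symm
  rw [le_div_iff₀ hΔ] at hJ1
  rw [div_lt_iff₀ hΔ] at hJ2
  obtain ⟨hI1, hI2⟩ := Int.floor_eq_iff.1 hI.symm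
  rw [← sub_le_iff_le_add, le_div_iff₀ hΔ] at hI1
  rw [← lt_sub_iff_add_lt, div_lt_iff₀ hΔ] at hI2
  have hIin : |I| ≤ (J : ℤ) → |v| ≤ u + Δ / 2 := by
    intro h
    obtain ⟨a, b⟩ := abs_le.1 h
    have a' : -(J : ℝ) ≤ I := by exact_mod_cast a
    have b' : (I : ℝ) ≤ J := by exact_mod_cast b
    rw [abs_le]
    constructor <;> nlinarith
  have hIout : ¬ |I| ≤ (J : ℤ) → u - Δ / 2 ≤ |v| := by
    intro h
    rw [not_le] at h
    rcases lt_abs.1 h with a | a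
    · have a' : (J : ℝ) + 1 ≤ I := by exact_mod_cast a
      refine le_trans ?_ (le_abs_self v)
      nlinarith
    · have a' : (J : ℝ) + 1 ≤ -I := by exact_mod_cast a
      refine le_trans ?_ (neg_le_abs v)
      nlinarith
  have hJn : J ≤ n ↔ u < R + Δ := by
    constructor
    · intro h
      have : (J : ℝ) ≤ n := by exact_mod_cast h
      nlinarith
    · intro h
      have : (J : ℝ) * Δ < (n + 1) * Δ := by linarith
      have : (J : ℝ) < n + 1 := lt_of_mul_lt_mul_right this hΔ.le
      exact Nat.lt_succ_iff.1 (by exact_mod_cast this)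
  have hexpJ : exp (-(lam * (J : ℝ) * Δ)) ≤ 1 := exp_le_one_iff.2 (by
    have : 0 ≤ lam * (J : ℝ) * Δ := by positivity
    linarith)
  have hexpu : exp (-(lam * u)) ≤ 1 := exp_le_one_iff.2 (by
    have : 0 ≤ lam * u := by positivity
    linarith)
  have hband : |v| ≤ u + Δ → u - Δ ≤ |v| → u ≤ R →
      (1 : ℝ) ≤ (if (0 ≤ u ∧ u ≤ R) ∧ |v - u| ≤ Δ then 1 else 0)
      + (if (0 ≤ u ∧ u ≤ R) ∧ |v + u| ≤ Δ then 1 else 0) := by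
    intro h1 h2 h3
    rcases le_total 0 v with hv | hv
    · rw [abs_of_nonneg hv] at h1 h2
      rw [if_pos ⟨⟨hu, h3⟩, abs_le.2 ⟨by linarith, by linarith⟩⟩]
      linarith
    · rw [abs_of_nonpos hv] at h1 h2
      rw [if_pos (c := (0 ≤ u ∧ u ≤ R) ∧ |v + u| ≤ Δ)
        ⟨⟨hu, h3⟩, abs_le.2 ⟨by linarith, by linarith⟩⟩]
      linarith
  by_cases huR : R < u
  · have hcancel : ∀ a b : ℝ, |a - b - a| = |b| := fun a b => by
      rw [show a - b - a = -b by ring, abs_neg]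
    simp only [hu, huR, true_and, hcancel] at n1 n2 n3 ⊢
    by_cases hc : J ≤ n ∧ |I| ≤ (J : ℤ)
    · obtain ⟨hc1, hc2⟩ := hc
      have hu2 := hJn.1 hc1
      rw [if_pos (c := (R ≤ u ∧ u ≤ R + Δ) ∧ |v| ≤ R + 2 * Δ)
        ⟨⟨huR.le, hu2.le⟩, by linarith [hIin hc2]⟩]
      rw [if_pos ⟨hc1, hc2⟩, abs_of_pos (exp_pos _)]
      linarith
    · rw [if_neg hc, abs_zero]
      linarith
  · rw [if_neg (c := R < u ∧ |v| ≤ u) (fun h => huR h.1), sub_zero]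
    rw [not_lt] at huR
    have hJn' : J ≤ n := hJn.2 (by linarith)
    simp only [hu, hJn', true_and] at *
    by_cases hv : |v| ≤ u <;> by_cases hc : |I| ≤ (J : ℤ)
    · rw [if_pos hv, if_pos hc]
      rw [if_pos (c := u ≤ R ∧ |v| ≤ R) ⟨huR, hv.trans huR⟩]
      have hle : lam * J * Δ ≤ lam * u := by
        rw [mul_assoc]; exact mul_le_mul_of_nonneg_left hJ1 hlam.le
      have hmono : exp (-(lam * u)) ≤ exp (-(lam * J * Δ)) := exp_le_exp.2 (by linarith)
      have hdiff : exp (-(lam * J * Δ)) - exp (-(lam * u)) ≤ lam * Δ := by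
        have h1 : exp (-(lam * u)) = exp (-(lam * J * Δ)) * exp (-(lam * (u - J * Δ))) := by
          rw [← exp_add]; congr 1; ring
        have h2 := add_one_le_exp (-(lam * (u - J * Δ)))
        have h3 : lam * (u - J * Δ) ≤ lam * Δ :=
          mul_le_mul_of_nonneg_left (by linarith) hlam.le
        have h4 : 0 ≤ lam * (u - J * Δ) := mul_nonneg hlam.le (by linarith)
        rw [h1]
        nlinarith [exp_pos (-(lam * J * Δ))]
      rw [abs_sub_comm, abs_of_nonneg (by linarith)]
      linarith
    · rw [if_pos hv, if_neg hc, sub_zero, abs_of_pos (exp_pos _)]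
      have := hband (by linarith) (by linarith [hIout hc]) huR
      linarith
    · rw [if_neg hv, if_pos hc, zero_sub, abs_neg, abs_of_pos (exp_pos _)]
      have := hband (by linarith [hIin hc]) (by linarith) huR
      linarith
    · rw [if_neg hv, if_neg hc, sub_zero, abs_zero]
      linarith

lemma abs_integral_sub_le_of_abs_sub_le {α : Type*} [MeasurableSpace α] {ν : Measure α}
    {f g G : α → ℝ} (hf : AEStronglyMeasurable f ν) (hg : Integrable g ν)
    (hg2 : Integrable (fun p => g p ^ 2) ν) (hG : Integrable G ν)
    (hfg : ∀ p, |f p - g p| ≤ G p) (hf1 : ∀ p, |f p| ≤ 1) (hg1 : ∀ p, |g p| ≤ 1) :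
    |(∫ p, f p ∂ν) - ∫ p, g p ∂ν| ≤ ∫ p, G p ∂ν ∧
    |(∫ p, f p ^ 2 ∂ν) - ∫ p, g p ^ 2 ∂ν| ≤ 2 * ∫ p, G p ∂ν := by
  have hd : Integrable (fun p => f p - g p) ν :=
    hG.mono' (hf.sub hg.1) (Eventually.of_forall hfg)
  have hfi : Integrable f ν :=
    (hd.add hg).congr (Eventually.of_forall fun p => sub_add_cancel (f p) (g p))
  have hb2 : ∀ p, |f p ^ 2 - g p ^ 2| ≤ 2 * G p := by
    intro p
    rw [sq_sub_sq, abs_mul]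
    have h1 : |f p + g p| ≤ 2 := (abs_add_le _ _).trans (by linarith [hf1 p, hg1 p])
    exact mul_le_mul h1 (hfg p) (abs_nonneg _) zero_le_two
  have hd2 : Integrable (fun p => f p ^ 2 - g p ^ 2) ν :=
    (hG.const_mul 2).mono' ((hf.pow 2).sub hg2.1) (Eventually.of_forall hb2)
  have hfi2 : Integrable (fun p => f p ^ 2) ν :=
    (hd2.add hg2).congr (Eventually.of_forall fun p => sub_add_cancel (f p ^ 2) (g p ^ 2))
  constructor
  · rw [← integral_sub hfi hg]
    exact norm_integral_le_of_norm_le (f := fun p => f p - g p) hG (Eventually.of_forall hfg)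
  · rw [← integral_sub hfi2 hg2, ← integral_const_mul]
    exact norm_integral_le_of_norm_le (f := fun p => f p ^ 2 - g p ^ 2) (hG.const_mul 2)
      (Eventually.of_forall hb2)

lemma integrable_and_integral_indicator_vertical_band {a : ℝ → ℝ} (ha : Measurable a)
    {c d r : ℝ} (hcd : c ≤ d) (hr : 0 ≤ r) (C : ℝ) :
    Integrable ({p : ℝ × ℝ | p.2 ∈ Set.Icc c d ∧ |p.1 - a p.2| ≤ r}.indicator fun _ => C) ∧
    ∫ p, {p : ℝ × ℝ | p.2 ∈ Set.Icc c d ∧ |p.1 - a p.2| ≤ r}.indicator (fun _ => C) p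
      = 2 * r * (d - c) * C := by
  obtain ⟨hm, hv⟩ := volume_vertical_band ha c d r
  constructor
  · rw [integrable_indicator_iff hm]
    refine integrableOn_const ?_
    rw [hv]
    finiteness
  · rw [integral_indicator hm, setIntegral_const, measureReal_def, hv, ENNReal.toReal_mul,
      ENNReal.toReal_ofReal (by positivity), ENNReal.toReal_ofReal (by linarith), smul_eq_mul]

/-- MSE of the rectangular-grid discrete convolution approximation of the canonical OU∧
process with c = 1: with truncation bound R = nΔ fixed and grid size Δ = R/n → 0,
`E|Y−Z|² = [4μ²λ⁻⁴(1+λR)² + τ²(2λ²)⁻¹(1+2λR)] e^{-2Rλ} + O(Δ)`; and the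
pure-truncation error over the complement region `{t−s > R} ∩ A_t(x)` evaluates exactly
to `4μ²λ⁻⁴(1+λR)² e^{-2Rλ} + τ²(2λ²)⁻¹(1+2λR) e^{-2Rλ}`. -/
theorem RG_MSE_truncation_asymptotics
    (lam R x t μ τ : ℝ) (hlam : 0 < lam) (hR : 0 < R)
    (k : ℝ × ℝ → ℝ)
    (hk : k = fun p => Set.indicator {p : ℝ × ℝ | p.2 ≤ t ∧ |p.1 - x| ≤ t - p.2}
      (fun q => Real.exp (-(lam * (t - q.2)))) p)
    (h : ℕ → ℝ × ℝ → ℝ)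
    (hh : h = fun n p =>
      ∑ j ∈ Finset.range (n + 1), ∑ i ∈ Finset.Icc (-(n : ℤ)) (n : ℤ),
        if |(i : ℝ) * (R / n)| ≤ (j : ℝ) * (R / n)
            ∧ p.2 ∈ Set.Ioc (t - ((j : ℝ) + 1) * (R / n)) (t - (j : ℝ) * (R / n))
            ∧ p.1 ∈ Set.Ico (x + (i : ℝ) * (R / n) - (R / n) / 2)
                (x + (i : ℝ) * (R / n) + (R / n) / 2)
        then Real.exp (-(lam * (j : ℝ) * (R / n))) else 0)
    (MSE : ℕ → ℝ)
    (hMSE : MSE = fun n => (μ * ∫ p : ℝ × ℝ, (k p - h n p)) ^ 2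
      + τ ^ 2 * ∫ p : ℝ × ℝ, (k p - h n p) ^ 2) :
    ((fun n : ℕ => MSE n
        - (4 * μ ^ 2 / lam ^ 4 * (1 + lam * R) ^ 2
          + τ ^ 2 / (2 * lam ^ 2) * (1 + 2 * lam * R)) * Real.exp (-(2 * R * lam)))
      =O[atTop] fun n : ℕ => R / (n : ℝ))
    ∧ ((μ * ∫ p in {p : ℝ × ℝ | R < t - p.2 ∧ |p.1 - x| ≤ t - p.2},
          Real.exp (-(lam * (t - p.2)))) ^ 2
        + τ ^ 2 * ∫ p in {p : ℝ × ℝ | R < t - p.2 ∧ |p.1 - x| ≤ t - p.2},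
          Real.exp (-(lam * (t - p.2))) ^ 2
      = 4 * μ ^ 2 / lam ^ 4 * (1 + lam * R) ^ 2 * Real.exp (-(2 * R * lam))
        + τ ^ 2 / (2 * lam ^ 2) * (1 + 2 * lam * R) * Real.exp (-(2 * R * lam))) := by
  set A := {p : ℝ × ℝ | R < t - p.2 ∧ |p.1 - x| ≤ t - p.2} with hA
  have hsq : ∀ s : ℝ, exp (-(lam * (t - s))) ^ 2 = exp (-((2 * lam) * (t - s))) := fun s => by
    rw [← Real.exp_nat_mul]; congr 1; push_cast; ring
  obtain ⟨hAm, hAi, hAv⟩ := integrableOn_and_setIntegral_truncated_cone_exp hlam hR x t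
  obtain ⟨-, hAi2, hAv2⟩ := integrableOn_and_setIntegral_truncated_cone_exp
    (show 0 < 2 * lam by positivity) hR x t
  rw [← hA] at hAm hAi hAv hAi2 hAv2
  set a := 2 * (1 + lam * R) * exp (-(lam * R)) / lam ^ 2 with ha
  set b := 2 * (1 + 2 * lam * R) * exp (-(2 * lam * R)) / (2 * lam) ^ 2 with hb
  have hexp : exp (-(2 * R * lam)) = exp (-(lam * R)) ^ 2 := by
    rw [← Real.exp_nat_mul]; congr 1; push_cast; ring
  have htarget : (μ * a) ^ 2 + τ ^ 2 * b
      = 4 * μ ^ 2 / lam ^ 4 * (1 + lam * R) ^ 2 * exp (-(2 * R * lam))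
        + τ ^ 2 / (2 * lam ^ 2) * (1 + 2 * lam * R) * exp (-(2 * R * lam)) := by
    rw [ha, hb, show -(2 * lam * R) = -(2 * R * lam) by ring, hexp]
    field_simp
    ring
  refine ⟨?_, by simp_rw [hsq]; rw [hAv, hAv2, htarget]⟩
  rw [add_mul, ← htarget]
  set g : ℝ × ℝ → ℝ := A.indicator (fun p => exp (-(lam * (t - p.2)))) with hg
  have hg2 : (fun p => g p ^ 2) = A.indicator (fun p => exp (-((2 * lam) * (t - p.2)))) := by
    ext p
    by_cases hp : p ∈ A <;> simp [hg, hp, hsq]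
  have hgi : Integrable g := (integrable_indicator_iff hAm).2 hAi
  have hgi2 : Integrable (fun p => g p ^ 2) := by
    rw [hg2]; exact (integrable_indicator_iff hAm).2 hAi2
  have hgv : ∫ p, g p = a := by rw [integral_indicator hAm, hAv]
  have hgv2 : ∫ p, g p ^ 2 = b := by rw [hg2, integral_indicator hAm, hAv2]
  have hexp1 : ∀ u : ℝ, 0 ≤ u → exp (-(lam * u)) ≤ 1 := fun u hu => exp_le_one_iff.2 (by
    have : 0 ≤ lam * u := by positivity
    linarith)
  have hg1 : ∀ p, |g p| ≤ 1 := by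
    intro p
    by_cases hp : p ∈ A
    · rw [hg, Set.indicator_of_mem hp, abs_of_pos (exp_pos _)]
      exact hexp1 _ (hR.trans hp.1).le
    · simp [hg, hp]
  have ha0 : 0 ≤ a := by positivity
  set C := 2 * lam * R ^ 2 + 10 * R with hC
  have hC0 : 0 ≤ C := by positivity
  have key : ∀ n : ℕ, 1 ≤ n → |(∫ p, (k p - h n p)) - a| ≤ C * (R / n) ∧
      |(∫ p, (k p - h n p) ^ 2) - b| ≤ 2 * (C * (R / n)) := by
    intro n hn
    have hn0 : (0 : ℝ) < n := by exact_mod_cast hn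
    have hΔ : 0 < R / n := by positivity
    have hRn : R = n * (R / n) := by field_simp
    have hΔR : R / n ≤ R := div_le_self hR.le (by exact_mod_cast hn)
    have hkp : ∀ p : ℝ × ℝ, k p = if 0 ≤ t - p.2 ∧ |p.1 - x| ≤ t - p.2
        then exp (-(lam * (t - p.2))) else 0 := by
      intro p
      rw [hk]
      simp only [Set.indicator, Set.mem_ofPred_eq, sub_nonneg]
    have hhp : ∀ p, h n p = _ := fun p =>
      (congrFun (congrFun hh n) p).trans (sum_grid_cells_eq lam x t (R / n) hΔ n p)
    have hgp : ∀ p : ℝ × ℝ, g p = if R < t - p.2 ∧ |p.1 - x| ≤ t - p.2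
        then exp (-(lam * (t - p.2))) else 0 := by
      intro p
      by_cases hp : p ∈ A
      · rw [hg, Set.indicator_of_mem hp]
        exact (if_pos hp).symm
      · rw [hg, Set.indicator_of_notMem hp]
        exact (if_neg hp).symm
    have hkm : Measurable k := by
      rw [hk]
      refine Measurable.indicator (by fun_prop) ?_
      refine (measurableSet_le measurable_snd measurable_const).inter
        (measurableSet_le (f := fun p : ℝ × ℝ => |p.1 - x|) (g := fun p => t - p.2) ?_
          (by fun_prop))
      simp_rw [← Real.norm_eq_abs]
      fun_prop
    have hhm : Measurable (h n) := by
      rw [hh]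
      refine Finset.measurable_sum _ fun j _ => Finset.measurable_sum _ fun i _ => ?_
      refine Measurable.ite ?_ measurable_const measurable_const
      exact (MeasurableSet.const _).inter
        ((measurable_snd measurableSet_Ioc).inter (measurable_fst measurableSet_Ico))
    have hf1 : ∀ p, |k p - h n p| ≤ 1 := by
      intro p
      have hk01 : 0 ≤ k p ∧ k p ≤ 1 := by
        rw [hkp]
        split_ifs with hc
        · exact ⟨(exp_pos _).le, hexp1 _ hc.1⟩
        · simp
      have hh01 : 0 ≤ h n p ∧ h n p ≤ 1 := by
        rw [hhp]
        split_ifs with hc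
        · rw [mul_assoc]
          exact ⟨(exp_pos _).le, hexp1 _ (by positivity)⟩
        · simp
      exact abs_le.2 ⟨by linarith, by linarith⟩
    set F₁ : ℝ × ℝ → ℝ := {p | p.2 ∈ Set.Icc (t - R) t ∧ |p.1 - x| ≤ R}.indicator
      fun _ => lam * (R / n)
    set F₂ : ℝ × ℝ → ℝ := {p | p.2 ∈ Set.Icc (t - R) t ∧ |p.1 - (x + (t - p.2))| ≤ R / n}.indicator
      fun _ => 1
    set F₃ : ℝ × ℝ → ℝ := {p | p.2 ∈ Set.Icc (t - R) t ∧ |p.1 - (x - (t - p.2))| ≤ R / n}.indicator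
      fun _ => 1
    set F₄ : ℝ × ℝ → ℝ := {p | p.2 ∈ Set.Icc (t - (R + R / n)) (t - R) ∧
      |p.1 - x| ≤ R + 2 * (R / n)}.indicator fun _ => 1
    have h₁ : Integrable F₁ ∧ ∫ p, F₁ p = _ := integrable_and_integral_indicator_vertical_band
      (a := fun _ => x) (by fun_prop) (by linarith) hR.le _
    have h₂ : Integrable F₂ ∧ ∫ p, F₂ p = _ := integrable_and_integral_indicator_vertical_band
      (a := fun s => x + (t - s)) (by fun_prop) (by linarith) hΔ.le _
    have h₃ : Integrable F₃ ∧ ∫ p, F₃ p = _ := integrable_and_integral_indicator_vertical_band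
      (a := fun s => x - (t - s)) (by fun_prop) (by linarith) hΔ.le _
    have h₄ : Integrable F₄ ∧ ∫ p, F₄ p = _ := integrable_and_integral_indicator_vertical_band
      (a := fun _ => x) (by fun_prop) (by linarith) (by positivity) _
    obtain ⟨i1, v1⟩ := h₁
    obtain ⟨i2, v2⟩ := h₂
    obtain ⟨i3, v3⟩ := h₃
    obtain ⟨i4, v4⟩ := h₄
    have hind : ∀ (c d r K : ℝ) (e : ℝ → ℝ) (P : ℝ × ℝ → Prop) [DecidablePred P],
        (∀ p, P p ↔ p.2 ∈ Set.Icc c d ∧ |p.1 - e p.2| ≤ r) →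
        ∀ p, (if P p then K else 0) =
          {p : ℝ × ℝ | p.2 ∈ Set.Icc c d ∧ |p.1 - e p.2| ≤ r}.indicator (fun _ => K) p := by
      intro c d r K e P _ hP p
      simp only [Set.indicator, Set.mem_ofPred_eq, ← hP]
    have hshift : ∀ s, (0 ≤ t - s ∧ t - s ≤ R) ↔ s ∈ Set.Icc (t - R) t := fun s => by
      rw [Set.mem_Icc]; constructor <;> rintro ⟨h1, h2⟩ <;> constructor <;> linarith
    have hshift' : ∀ s, (R ≤ t - s ∧ t - s ≤ R + R / n) ↔
        s ∈ Set.Icc (t - (R + R / n)) (t - R) := fun s => by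
      rw [Set.mem_Icc]; constructor <;> rintro ⟨h1, h2⟩ <;> constructor <;> linarith
    have hbound : ∀ p, |k p - h n p - g p| ≤ (F₁ + F₂ + F₃ + F₄) p := by
      intro p
      rw [hkp, hhp, hgp]
      exact (abs_kernel_sub_grid_sub_tail_le hlam hΔ hRn (t - p.2) (p.1 - x)).trans_eq
        (congrArg₂ (· + ·) (congrArg₂ (· + ·) (congrArg₂ (· + ·)
          (hind (t - R) t R (lam * (R / n)) (fun _ => x)
            (fun p => (0 ≤ t - p.2 ∧ t - p.2 ≤ R) ∧ |p.1 - x| ≤ R)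
            (fun p => by rw [hshift]) p)
          (hind (t - R) t (R / n) 1 (fun s => x + (t - s))
            (fun p => (0 ≤ t - p.2 ∧ t - p.2 ≤ R) ∧ |p.1 - x - (t - p.2)| ≤ R / n)
            (fun p => by rw [hshift, sub_sub]) p))
          (hind (t - R) t (R / n) 1 (fun s => x - (t - s))
            (fun p => (0 ≤ t - p.2 ∧ t - p.2 ≤ R) ∧ |p.1 - x + (t - p.2)| ≤ R / n)
            (fun p => by rw [hshift, sub_add]) p))
          (hind (t - (R + R / n)) (t - R) (R + 2 * (R / n)) 1 (fun _ => x)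
            (fun p => (R ≤ t - p.2 ∧ t - p.2 ≤ R + R / n) ∧ |p.1 - x| ≤ R + 2 * (R / n))
            (fun p => by rw [hshift']) p))
    have hmain := abs_integral_sub_le_of_abs_sub_le (hkm.sub hhm).aestronglyMeasurable hgi hgi2
      (((i1.add i2).add i3).add i4) hbound hf1 hg1
    have hG : ∫ p, (F₁ + F₂ + F₃ + F₄) p ≤ C * (R / n) := by
      rw [integral_add' ((i1.add i2).add i3) i4, integral_add' (i1.add i2) i3,
        integral_add' i1 i2, v1, v2, v3, v4, hC]
      nlinarith
    rw [hgv, hgv2] at hmain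
    exact ⟨hmain.1.trans hG, hmain.2.trans (by linarith)⟩
  refine IsBigO.of_bound (μ ^ 2 * (C * (C * R + 2 * a)) + τ ^ 2 * (2 * C)) ?_
  filter_upwards [eventually_ge_atTop 1] with n hn
  obtain ⟨h1, h2⟩ := key n hn
  have hΔ : 0 ≤ R / (n : ℝ) := by positivity
  have hΔR : R / n ≤ R := div_le_self hR.le (by exact_mod_cast hn)
  rw [hMSE, Real.norm_eq_abs, Real.norm_eq_abs, abs_of_nonneg hΔ]
  dsimp only
  set I := ∫ p, (k p - h n p)
  set I' := ∫ p, (k p - h n p) ^ 2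
  rw [show (μ * I) ^ 2 + τ ^ 2 * I' - ((μ * a) ^ 2 + τ ^ 2 * b)
    = μ ^ 2 * ((I - a) * (I + a)) + τ ^ 2 * (I' - b) by ring]
  have h3 : |I + a| ≤ C * R + 2 * a := by
    rw [show I + a = (I - a) + 2 * a by ring]
    refine (abs_add_le _ _).trans ?_
    rw [abs_of_nonneg (by positivity : 0 ≤ 2 * a)]
    have := mul_le_mul_of_nonneg_left hΔR hC0
    linarith
  have h4 : |I - a| * |I + a| ≤ C * (R / n) * (C * R + 2 * a) :=
    mul_le_mul h1 h3 (abs_nonneg _) (by positivity)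
  refine (abs_add_le _ _).trans ?_
  rw [abs_mul, abs_mul, abs_mul, abs_of_nonneg (sq_nonneg μ), abs_of_nonneg (sq_nonneg τ)]
  have h5 := mul_le_mul_of_nonneg_left h4 (sq_nonneg μ)
  have h6 := mul_le_mul_of_nonneg_left h2 (sq_nonneg τ)
  linarith
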